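/- arXiv:0709.2513 — 4 statements merged into one kernel-verified Lean document; each statement's English description precedes it below -/
import Mathlib

section
/- For every z ∈ ℍ with Im z ≥ 1/2, one has ( dist(z, z+1) / 2 ) · ( 2·Im z ) ≥ arsinh 1. That is, the half-displacement of the parabolic isometry z ↦ z+1 at z, multiplied by the exponential e^{δ(z)} = 2·Im z of the signed hyperbolic distance δ(z) = log(2·Im z) from z past the horocycle {Im w = 1/2}, is bounded below by the universal positive constant arsinh 1. -/
open UpperHalfPlane

theorem concaveOn_arsinh : ConcaveOn ℝ (Set.Ici 0) Real.arsinh := by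
  refine AntitoneOn.concaveOn_of_deriv (convex_Ici 0) Real.continuous_arsinh.continuousOn
    Real.differentiable_arsinh.differentiableOn ?_
  intro x hx y _ hxy
  rw [interior_Ici, Set.mem_Ioi] at hx
  rw [(Real.hasDerivAt_arsinh x).deriv, (Real.hasDerivAt_arsinh y).deriv]
  gcongr

/-- The half-displacement of the translation `z ↦ z + 1`. -/
theorem half_dist_eq_arsinh_of_coe_eq_add_one {z w : ℍ} (hw : (w : ℂ) = (z : ℂ) + 1) :
    dist z w / 2 = Real.arsinh (1 / (2 * z.im)) := by
  have him : w.im = z.im := by simpa using congrArg Complex.im hw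
  have hd : dist (z : ℂ) w = 1 := by simp [hw, dist_eq_norm]
  rw [UpperHalfPlane.dist_eq, mul_div_cancel_left₀ _ two_ne_zero, hd, him,
    Real.sqrt_mul_self z.im_pos.le]

/-- For every `z ∈ ℍ` with `Im z ≥ 1/2`, the half-displacement of the
parabolic isometry `z ↦ z + 1` at `z`, multiplied by `e^{δ(z)} = 2·Im z` (the exponential
of the signed distance past the horocycle `{Im w = 1/2}`), is at least `arsinh 1`. -/
theorem cusp_injectivity_radius_bound (z w : ℍ) (hz : 1 / 2 ≤ z.im)
    (hw : (w : ℂ) = (z : ℂ) + 1) :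
    Real.arsinh 1 ≤ dist z w / 2 * (2 * z.im) := by
  have hpos : 0 < 2 * z.im := mul_pos two_pos z.im_pos
  have ht : 1 / (2 * z.im) ≤ 1 := by rw [div_le_one hpos]; linarith
  have h := concaveOn_arsinh.2 (Set.mem_Ici.2 zero_le_one) (Set.mem_Ici.2 le_rfl)
    (one_div_pos.2 hpos).le (sub_nonneg.2 ht) (add_sub_cancel _ _)
  simp only [smul_eq_mul, mul_one, mul_zero, add_zero, Real.arsinh_zero] at h
  rw [half_dist_eq_arsinh_of_coe_eq_add_one hw, ← div_le_iff₀ hpos, div_eq_mul_one_div, mul_comm]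
  exact h
end

section
/- There is a universal constant c > 0 with the following property. For every 0 < ℓ ≤ 2, let w(ℓ) = arsinh(1/sinh(ℓ/2)) (so sinh w(ℓ)·sinh(ℓ/2) = 1). Then for every z ∈ ℍ whose hyperbolic distance d to the imaginary axis {w ∈ ℍ : Re w = 0} satisfies d ≤ w(ℓ), one has ( dist(z, e^{ℓ} z) / 2 ) · e^{ w(ℓ) − d } ≥ c. -/
open UpperHalfPlane

/-- A point at distance `d` from the imaginary axis satisfies `exp d ≤ 2 |z| / Im z`. -/
lemma exp_infDist_imaginary_axis_le (z : ℍ) :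
    Real.exp (Metric.infDist z {v : ℍ | v.re = 0}) ≤ 2 * (‖(z : ℂ)‖ / z.im) := by
  have hz : 0 < ‖(z : ℂ)‖ := norm_pos_iff.2 z.ne_zero
  have hy := z.im_pos
  let v : ℍ := ⟨⟨0, ‖(z : ℂ)‖⟩, hz⟩
  have hd : Metric.infDist z {v : ℍ | v.re = 0} ≤ dist z v :=
    Metric.infDist_le_dist_of_mem (show v.re = 0 from rfl)
  have hn : ‖(z : ℂ)‖ ^ 2 = z.re ^ 2 + z.im ^ 2 := by
    rw [Complex.sq_norm, Complex.normSq_apply, coe_re, coe_im]; ring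
  have hc : Real.cosh (dist z v) = ‖(z : ℂ)‖ / z.im := by
    rw [cosh_dist']
    change ((z.re - 0) ^ 2 + z.im ^ 2 + ‖(z : ℂ)‖ ^ 2) / (2 * z.im * ‖(z : ℂ)‖) = _
    field_simp
    linarith
  have he := Real.exp_le_exp.2 hd
  have hpos := Real.exp_pos (-dist z v)
  rw [Real.cosh_eq] at hc
  linarith

lemma sinh_half_dist_of_coe_eq_exp_mul {ℓ : ℝ} (hℓ : 0 ≤ ℓ) {z w : ℍ}
    (h : (w : ℂ) = (Real.exp ℓ : ℂ) * (z : ℂ)) :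
    Real.sinh (dist z w / 2) = ‖(z : ℂ)‖ / z.im * Real.sinh (ℓ / 2) := by
  have hy := z.im_pos
  have he : Real.exp ℓ = Real.exp (ℓ / 2) ^ 2 := by
    rw [← Real.exp_nat_mul]; congr 1; push_cast; ring
  have hw : w.im = Real.exp ℓ * z.im := by
    rw [← coe_im, h, Complex.im_ofReal_mul, coe_im]
  have hs : √(z.im * w.im) = z.im * Real.exp (ℓ / 2) := by
    rw [hw, he, ← Real.sqrt_sq (by positivity : 0 ≤ z.im * Real.exp (ℓ / 2))]
    congr 1; ring
  have hdist : dist (z : ℂ) w = (Real.exp ℓ - 1) * ‖(z : ℂ)‖ := by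
    have h1 : (0 : ℝ) ≤ Real.exp ℓ - 1 := by linarith [Real.one_le_exp hℓ]
    rw [dist_comm, dist_eq_norm, h,
      show (Real.exp ℓ : ℂ) * z - z = ((Real.exp ℓ - 1 : ℝ) : ℂ) * z by push_cast; ring,
      norm_mul, Complex.norm_real, Real.norm_of_nonneg h1]
  rw [sinh_half_dist, hs, hdist, Real.sinh_eq, Real.exp_neg, he]
  have := Real.exp_pos (ℓ / 2)
  field_simp

lemma sinh_le_two_mul {u : ℝ} (h0 : 0 ≤ u) (h1 : u ≤ 1) : Real.sinh u ≤ 2 * u := by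
  have ha : |u| ≤ 1 := by rwa [abs_of_nonneg h0]
  have hp := le_of_abs_le (Real.abs_exp_sub_one_le ha)
  have hm := neg_le_of_abs_le (Real.abs_exp_sub_one_le (x := -u) (by rwa [abs_neg]))
  rw [abs_neg] at hm
  rw [abs_of_nonneg h0] at hp hm
  rw [Real.sinh_eq]
  linarith

lemma two_mul_le_exp_arsinh (x : ℝ) : 2 * x ≤ Real.exp (Real.arsinh x) := by
  have : x ≤ √(1 + x ^ 2) := Real.le_sqrt_of_sq_le (by linarith)
  rw [Real.exp_arsinh]
  linarith

/-- There is a universal constant `c > 0` such that for every `0 < ℓ ≤ 2`,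
with collar half-width `w(ℓ) = arsinh(1/sinh(ℓ/2))`, and every `z ∈ ℍ` whose hyperbolic
distance `d` to the imaginary axis satisfies `d ≤ w(ℓ)`, one has
`(dist(z, e^ℓ z)/2) · e^{w(ℓ) − d} ≥ c`. -/
theorem collar_injectivity_radius_bound :
    ∃ c > (0 : ℝ), ∀ ℓ : ℝ, 0 < ℓ → ℓ ≤ 2 → ∀ z w : ℍ,
      (w : ℂ) = (Real.exp ℓ : ℂ) * (z : ℂ) →
      Metric.infDist z {v : ℍ | v.re = 0} ≤ Real.arsinh (1 / Real.sinh (ℓ / 2)) →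
      c ≤ dist z w / 2 *
        Real.exp (Real.arsinh (1 / Real.sinh (ℓ / 2)) - Metric.infDist z {v : ℍ | v.re = 0}) := by
  refine ⟨1 / 2, by norm_num, fun ℓ hℓ _ z w hw hd => ?_⟩
  have hs : 0 < Real.sinh (ℓ / 2) := Real.sinh_pos_iff.2 (by linarith)
  have ht : 0 < ‖(z : ℂ)‖ / z.im := div_pos (norm_pos_iff.2 z.ne_zero) z.im_pos
  have hX := sinh_half_dist_of_coe_eq_exp_mul hℓ.le hw
  have hu : 0 ≤ dist z w / 2 := by positivity
  rcases le_total (1 / 2) (dist z w / 2) with h | h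
  · exact h.trans (le_mul_of_one_le_right hu (Real.one_le_exp (sub_nonneg.2 hd)))
  · have h2 := sinh_le_two_mul hu (by linarith)
    have h3 := exp_infDist_imaginary_axis_le z
    have h4 := two_mul_le_exp_arsinh (1 / Real.sinh (ℓ / 2))
    rw [hX] at h2
    rw [Real.exp_sub, ← mul_div_assoc, le_div_iff₀ (Real.exp_pos _)]
    calc 1 / 2 * Real.exp (Metric.infDist z {v : ℍ | v.re = 0})
        ≤ ‖(z : ℂ)‖ / z.im := by linarith
      _ = ‖(z : ℂ)‖ / z.im * Real.sinh (ℓ / 2) / 2 * (2 * (1 / Real.sinh (ℓ / 2))) := by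
          field_simp
      _ ≤ dist z w / 2 * Real.exp (Real.arsinh (1 / Real.sinh (ℓ / 2))) :=
          mul_le_mul (by linarith) h4 (by positivity) hu
end

section
/- Let u(θ) = 1 − θ·cot θ and define v : (0,π) → ℝ by v(θ) = min{ u(θ), u(π−θ) }. Then v is comparable to sin²θ: there exists a constant c ≥ 1 such that for all θ ∈ (0,π), (1/c)·sin²θ ≤ v(θ) ≤ c·sin²θ. -/
/-- The function `u(θ) = 1 − θ·cot θ`. -/
noncomputable def uFun (θ : ℝ) : ℝ := 1 - θ * Real.cos θ / Real.sin θ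

/-- The modification `v(θ) = min{u(θ), u(π−θ)}`. -/
noncomputable def vFun (θ : ℝ) : ℝ := min (uFun θ) (uFun (Real.pi - θ))

open Real in
theorem mul_one_add_cos_le_two_mul_sin {θ : ℝ} (h0 : 0 < θ) (hπ : θ < π) :
    θ * (1 + cos θ) ≤ 2 * sin θ := by
  have hc : 0 < cos (θ / 2) := cos_pos_of_mem_Ioo ⟨by linarith, by linarith⟩
  have ht : θ / 2 < tan (θ / 2) := lt_tan (by linarith) (by linarith)
  rw [tan_eq_sin_div_cos, lt_div_iff₀ hc] at ht
  have hcos : cos θ = 2 * cos (θ / 2) ^ 2 - 1 := by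
    rw [← cos_two_mul, mul_div_cancel₀ θ two_ne_zero]
  have hsin : sin θ = 2 * sin (θ / 2) * cos (θ / 2) := by
    rw [← sin_two_mul, mul_div_cancel₀ θ two_ne_zero]
  rw [hcos, hsin]
  nlinarith [mul_lt_mul_of_pos_right ht hc]

open Real in
theorem sin_sq_div_four_le_uFun {θ : ℝ} (h0 : 0 < θ) (hπ : θ < π) :
    1 / 4 * sin θ ^ 2 ≤ uFun θ := by
  have hs : 0 < sin θ := sin_pos_of_pos_of_lt_pi h0 hπ
  have hsc := sin_sq_add_cos_sq θ
  suffices h : θ * cos θ ≤ (1 - 1 / 4 * sin θ ^ 2) * sin θ by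
    have := (div_le_iff₀ hs).2 h
    unfold uFun
    linarith
  have hS : 0 ≤ 1 - 1 / 4 * sin θ ^ 2 := by nlinarith [sq_nonneg (cos θ)]
  rcases le_or_gt (cos θ) 0 with hc | hc
  · exact (mul_nonpos_of_nonneg_of_nonpos h0.le hc).trans (mul_nonneg hS hs.le)
  · have key : 2 * cos θ ≤ (1 - 1 / 4 * sin θ ^ 2) * (1 + cos θ) := by
      have hsq : sin θ ^ 2 = (1 - cos θ) * (1 + cos θ) := by linarith
      have h1 := cos_le_one θ
      have h2 : (1 + cos θ) ^ 2 ≤ 4 := by nlinarith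
      rw [hsq]
      nlinarith [mul_le_mul_of_nonneg_left h2 (sub_nonneg.2 h1)]
    refine le_of_mul_le_mul_right ?_ (by linarith : 0 < 1 + cos θ)
    calc θ * cos θ * (1 + cos θ) = θ * (1 + cos θ) * cos θ := by ring
      _ ≤ 2 * sin θ * cos θ :=
        mul_le_mul_of_nonneg_right (mul_one_add_cos_le_two_mul_sin h0 hπ) hc.le
      _ = 2 * cos θ * sin θ := by ring
      _ ≤ (1 - 1 / 4 * sin θ ^ 2) * (1 + cos θ) * sin θ := mul_le_mul_of_nonneg_right key hs.le
      _ = _ := by ring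

open Real in
theorem uFun_le_sin_sq {θ : ℝ} (h0 : 0 < θ) (hπ : θ ≤ π / 2) : uFun θ ≤ sin θ ^ 2 := by
  have hs : 0 < sin θ := sin_pos_of_pos_of_lt_pi h0 (by linarith [pi_pos])
  have hc : 0 ≤ cos θ := cos_nonneg_of_neg_pi_div_two_le_of_le (by linarith) hπ
  have h : cos θ ≤ θ * cos θ / sin θ := by
    rw [le_div_iff₀ hs, mul_comm]
    exact mul_le_mul_of_nonneg_right (sin_le h0.le) hc
  unfold uFun
  nlinarith [sin_sq_add_cos_sq θ, cos_le_one θ]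

/-- `v(θ) = min{u(θ), u(π−θ)}` is comparable to `sin²θ` on `(0,π)`:
there is `c ≥ 1` with `(1/c)·sin²θ ≤ v(θ) ≤ c·sin²θ` for all `θ ∈ (0,π)`. -/
theorem vFun_comparable_sin_sq :
    ∃ c : ℝ, 1 ≤ c ∧ ∀ θ : ℝ, 0 < θ → θ < Real.pi →
      (1 / c) * Real.sin θ ^ 2 ≤ vFun θ ∧ vFun θ ≤ c * Real.sin θ ^ 2 := by
  refine ⟨4, by norm_num, fun θ h0 hπ => ⟨le_min (sin_sq_div_four_le_uFun h0 hπ) ?_, ?_⟩⟩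
  · simpa only [Real.sin_pi_sub] using
      sin_sq_div_four_le_uFun (sub_pos.2 hπ) (sub_lt_self Real.pi h0)
  · have hv : vFun θ ≤ Real.sin θ ^ 2 := by
      rcases le_total θ (Real.pi / 2) with h | h
      · exact (min_le_left _ _).trans (uFun_le_sin_sq h0 h)
      · rw [← Real.sin_pi_sub]
        exact (min_le_right _ _).trans (uFun_le_sin_sq (sub_pos.2 hπ) (by linarith))
    linarith [sq_nonneg (Real.sin θ)]
end

section
/- For every ε > 0 there is a constant c = c(ε) > 0 such that the function f(z) = e^{-2 d(z, A)}, where d(z, A) is the hyperbolic distance from z to the imaginary axis A = {w ∈ ℍ : Re w = 0}, satisfies the mean value estimate f(p) ≤ c · ∫_{B(p,ε)} f dA for every p ∈ ℍ, where B(p,ε) is the hyperbolic metric ball of radius ε about p and dA is the hyperbolic area measure. -/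
open UpperHalfPlane MeasureTheory

noncomputable instance : MeasurableSpace UpperHalfPlane := borel UpperHalfPlane

/-- The hyperbolic area measure `dA = y⁻² dx dy` on the upper half-plane. -/
noncomputable def hyperbolicArea : Measure ℍ :=
  Measure.comap (fun z : ℍ => (z : ℂ))
    (volume.withDensity fun z : ℂ => ENNReal.ofReal (1 / z.im ^ 2))

instance : BorelSpace ℍ := ⟨rfl⟩

theorem hyperbolicArea_ball (p : ℍ) (r : ℝ) :
    hyperbolicArea (Metric.ball p r) =
      ∫⁻ z in Metric.ball (p.center r : ℂ) (p.im * Real.sinh r),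
        ENNReal.ofReal (1 / z.im ^ 2) := by
  have h : MeasurableEmbedding (fun z : ℍ => (z : ℂ)) :=
    UpperHalfPlane.isOpenEmbedding_coe.measurableEmbedding
  rw [hyperbolicArea, h.comap_apply, UpperHalfPlane.image_coe_ball,
    withDensity_apply _ Metric.isOpen_ball.measurableSet]

theorem im_mem_Ioo_of_mem_ball_center {p : ℍ} {r : ℝ} {z : ℂ}
    (hz : z ∈ Metric.ball (p.center r : ℂ) (p.im * Real.sinh r)) :
    z.im ∈ Set.Ioo (p.im * Real.exp (-r)) (p.im * Real.exp r) := by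
  rw [Metric.mem_ball, Complex.dist_eq] at hz
  have h := abs_lt.1 ((Complex.abs_im_le_norm _).trans_lt hz)
  rw [Complex.sub_im, UpperHalfPlane.coe_im, UpperHalfPlane.center_im] at h
  have h₁ := congrArg (p.im * ·) (Real.cosh_add_sinh r)
  have h₂ := congrArg (p.im * ·) (Real.cosh_sub_sinh r)
  simp only [mul_add, mul_sub] at h₁ h₂
  constructor <;> linarith [h.1, h.2]

theorem hyperbolicArea_ball_lt_top (p : ℍ) (r : ℝ) :
    hyperbolicArea (Metric.ball p r) < ⊤ := by
  rw [hyperbolicArea_ball]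
  refine setLIntegral_lt_top_of_le_nnreal measure_ball_lt_top.ne
    ⟨(1 / (p.im * Real.exp (-r)) ^ 2).toNNReal, fun z hz => ?_⟩
  have hp := p.im_pos
  have h := (im_mem_Ioo_of_mem_ball_center hz).1
  change ENNReal.ofReal _ ≤ ENNReal.ofReal _
  gcongr

theorem le_hyperbolicArea_real_ball (p : ℍ) {r : ℝ} (hr : 0 < r) :
    Real.pi * (Real.sinh r / Real.exp r) ^ 2 ≤ hyperbolicArea.real (Metric.ball p r) := by
  have hp := p.im_pos
  have hs : 0 < Real.sinh r := Real.sinh_pos_iff.2 hr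
  rw [Measure.real, ← ENNReal.ofReal_le_iff_le_toReal (hyperbolicArea_ball_lt_top p r).ne,
    hyperbolicArea_ball]
  calc ENNReal.ofReal (Real.pi * (Real.sinh r / Real.exp r) ^ 2)
      = ENNReal.ofReal (1 / (p.im * Real.exp r) ^ 2) *
          volume (Metric.ball (p.center r : ℂ) (p.im * Real.sinh r)) := by
        rw [Complex.volume_ball, ← ENNReal.ofReal_pow (by positivity),
          ← ENNReal.ofReal_coe_nnreal, NNReal.coe_real_pi, ← ENNReal.ofReal_mul (by positivity),
          ← ENNReal.ofReal_mul (by positivity)]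
        congr 1
        field_simp
    _ = ∫⁻ _ in Metric.ball (p.center r : ℂ) (p.im * Real.sinh r),
          ENNReal.ofReal (1 / (p.im * Real.exp r) ^ 2) := (setLIntegral_const _ _).symm
    _ ≤ _ := by
        refine setLIntegral_mono' Metric.isOpen_ball.measurableSet fun z hz => ?_
        have h := im_mem_Ioo_of_mem_ball_center hz
        have hz' : 0 < z.im := lt_trans (by positivity) h.1
        have h₂ := h.2
        gcongr

theorem exp_neg_two_infDist_le_integral_ball {s : Set ℍ} (p : ℍ) {r : ℝ} (hr : 0 < r) :
    Real.exp (-2 * r) * (Real.pi * (Real.sinh r / Real.exp r) ^ 2) *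
        Real.exp (-2 * Metric.infDist p s) ≤
      ∫ z in Metric.ball p r, Real.exp (-2 * Metric.infDist z s) ∂hyperbolicArea := by
  have hfin := hyperbolicArea_ball_lt_top p r
  have hcont : Continuous fun z : ℍ => Real.exp (-2 * Metric.infDist z s) :=
    Real.continuous_exp.comp (continuous_const.mul (Metric.continuous_infDist_pt s))
  have hint : IntegrableOn (fun z : ℍ => Real.exp (-2 * Metric.infDist z s))
      (Metric.ball p r) hyperbolicArea := by
    refine Measure.integrableOn_of_bounded (M := 1) hfin.ne
      hcont.aestronglyMeasurable (ae_of_all _ fun z => ?_)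
    rw [Real.norm_eq_abs, Real.abs_exp, Real.exp_le_one_iff]
    linarith [Metric.infDist_nonneg (x := z) (s := s)]
  have hle : ∀ z ∈ Metric.ball p r,
      Real.exp (-2 * r) * Real.exp (-2 * Metric.infDist p s) ≤
        Real.exp (-2 * Metric.infDist z s) := fun z hz => by
    rw [← Real.exp_add, Real.exp_le_exp]
    linarith [Metric.infDist_le_infDist_add_dist (s := s) (x := z) (y := p),
      Metric.mem_ball.1 hz]
  refine le_trans ?_
    (setIntegral_ge_of_const_le_real Metric.isOpen_ball.measurableSet hfin.ne hle hint)
  have h := le_hyperbolicArea_real_ball p hr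
  calc _ = Real.exp (-2 * r) * Real.exp (-2 * Metric.infDist p s) *
        (Real.pi * (Real.sinh r / Real.exp r) ^ 2) := by ring
    _ ≤ _ := by gcongr

/-- For each `ε > 0` there is `c = c(ε) > 0` such that the
exponential-distance function `f(z) = e^{-2 d(z, A)}`, `A` the imaginary axis, satisfies
the mean value estimate `f(p) ≤ c·∫_{B(p,ε)} f dA` for all `p ∈ ℍ` (hyperbolic balls and
hyperbolic area measure). -/
theorem exp_neg_two_dist_mean_value_estimate (ε : ℝ) (hε : 0 < ε) :
    ∃ c > (0 : ℝ), ∀ p : ℍ,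
      Real.exp (-2 * Metric.infDist p {w : ℍ | w.re = 0}) ≤
        c * ∫ z in Metric.ball p ε,
              Real.exp (-2 * Metric.infDist z {w : ℍ | w.re = 0}) ∂hyperbolicArea := by
  have hs : 0 < Real.sinh ε := Real.sinh_pos_iff.2 hε
  have hpos : 0 < Real.exp (-2 * ε) * (Real.pi * (Real.sinh ε / Real.exp ε) ^ 2) := by
    positivity
  refine ⟨_, inv_pos.2 hpos, fun p => ?_⟩
  rw [inv_mul_eq_div, le_div_iff₀ hpos, mul_comm]
  exact exp_neg_two_infDist_le_integral_ball p hε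
end
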